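/- arXiv:2511.22305 — 2 statements merged into one kernel-verified Lean document; each statement's English description precedes it below -/
import Mathlib

section
/- Let n ≥ 1 and let Σ₁, Σ₂ be real symmetric positive semidefinite n×n matrices that commute (Σ₁Σ₂ = Σ₂Σ₁), and let μ₁, μ₂ ∈ ℝⁿ. Suppose 0 < λ_min ≤ λ_max and every eigenvalue of Σ₁ and of Σ₂ lies in the interval [λ_min, λ_max]. Define the squared descriptor distance Δ² = ‖μ₁ − μ₂‖₂² + ‖Σ₁ − Σ₂‖_F² and the squared Gaussian 2-Wasserstein distance in closed form W = ‖μ₁ − μ₂‖₂² + Tr(Σ₁) + Tr(Σ₂) − 2 Tr((Σ₁^{1/2} Σ₂ Σ₁^{1/2})^{1/2}). Then with c₋ = min{1, 1/(2√λ_max)} and c₊ = max{1, 1/(2√λ_min)} one has c₋² · Δ² ≤ W ≤ c₊² · Δ². -/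
open Matrix

open scoped ComplexOrder in
/-- The positive semidefinite square root of a positive semidefinite matrix
(the definition of the older Mathlib, which has been removed since). -/
noncomputable def Matrix.PosSemidef.sqrt {n 𝕜 : Type*} [Fintype n] [RCLike 𝕜] [DecidableEq n]
    {A : Matrix n n 𝕜} (hA : A.PosSemidef) : Matrix n n 𝕜 :=
  hA.1.eigenvectorUnitary.1 * diagonal ((↑) ∘ Real.sqrt ∘ hA.1.eigenvalues) *
  (star hA.1.eigenvectorUnitary : Matrix n n 𝕜)

open scoped ComplexOrder in
lemma Matrix.PosSemidef.posSemidef_sqrt {n 𝕜 : Type*} [Fintype n] [RCLike 𝕜] [DecidableEq n]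
    {A : Matrix n n 𝕜} (hA : A.PosSemidef) : hA.sqrt.PosSemidef := by
  apply PosSemidef.mul_mul_conjTranspose_same
  refine posSemidef_diagonal_iff.mpr fun i ↦ ?_
  rw [Function.comp_apply, RCLike.nonneg_iff]
  constructor
  · simp only [RCLike.ofReal_re]
    exact Real.sqrt_nonneg _
  · simp only [RCLike.ofReal_im]

/-- Squared Frobenius norm `‖A‖_F² = ∑ i j, (A i j)²`. -/
noncomputable def frobSq {n : ℕ} (A : Matrix (Fin n) (Fin n) ℝ) : ℝ :=
  ∑ i, ∑ j, (A i j) ^ 2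

/-- For PSD matrices `A, B`, the matrix `A^{1/2} B A^{1/2}` is positive semidefinite. -/
lemma mid_posSemidef {n : ℕ} {A B : Matrix (Fin n) (Fin n) ℝ}
    (hA : A.PosSemidef) (hB : B.PosSemidef) :
    (hA.sqrt * B * hA.sqrt).PosSemidef := by
  have h := hB.mul_mul_conjTranspose_same hA.sqrt
  rwa [show (hA.sqrt)ᴴ = hA.sqrt from hA.posSemidef_sqrt.isHermitian] at h

section SquareRoot

open scoped MatrixOrder

variable {n : Type*} [Fintype n] [DecidableEq n] {A B : Matrix n n ℝ}

lemma Matrix.PosSemidef.sqrt_eq_cfc (hA : A.PosSemidef) : hA.sqrt = cfc Real.sqrt A := by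
  rw [hA.1.cfc_eq, IsHermitian.cfc, Unitary.conjStarAlgAut_apply]
  rfl

lemma Matrix.PosSemidef.sqrt_eq_cfcSqrt (hA : A.PosSemidef) : hA.sqrt = CFC.sqrt A := by
  rw [hA.sqrt_eq_cfc, CFC.sqrt_eq_real_sqrt A hA.nonneg, cfcₙ_eq_cfc]

lemma Matrix.PosSemidef.sqrt_mul_sqrt_self (hA : A.PosSemidef) : hA.sqrt * hA.sqrt = A := by
  rw [hA.sqrt_eq_cfcSqrt, CFC.sqrt_mul_sqrt_self A hA.nonneg]

lemma Matrix.PosSemidef.sqrt_eq_of_mul_self_eq (hA : A.PosSemidef) (hB : B.PosSemidef)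
    (h : B * B = A) : hA.sqrt = B := by
  rw [hA.sqrt_eq_cfcSqrt]
  exact CFC.sqrt_unique h hB.nonneg

lemma Matrix.PosSemidef.commute_sqrt (hA : A.PosSemidef) (hB : B.PosSemidef)
    (h : Commute A B) : Commute hA.sqrt hB.sqrt := by
  rw [hA.sqrt_eq_cfc, hB.sqrt_eq_cfc]
  exact ((h.cfc_real Real.sqrt).symm.cfc_real Real.sqrt).symm

lemma Matrix.PosSemidef.mul_of_commute (hA : A.PosSemidef) (hB : B.PosSemidef)
    (h : Commute A B) : (A * B).PosSemidef :=
  nonneg_iff_posSemidef.1 (Commute.mul_nonneg hA.nonneg hB.nonneg h)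

lemma Matrix.PosSemidef.smul_one_le_sqrt (hA : A.PosSemidef) {l : ℝ}
    (hl : ∀ i, l ≤ hA.1.eigenvalues i) : Real.sqrt l • (1 : Matrix n n ℝ) ≤ hA.sqrt := by
  rw [hA.sqrt_eq_cfc, ← Algebra.algebraMap_eq_smul_one]
  refine (algebraMap_le_cfc_iff Real.sqrt _ A (ha := hA.1)).2 fun x hx ↦ ?_
  rw [hA.1.spectrum_real_eq_range_eigenvalues] at hx
  obtain ⟨i, rfl⟩ := hx
  exact Real.sqrt_le_sqrt (hl i)

lemma Matrix.PosSemidef.sqrt_le_smul_one (hA : A.PosSemidef) {l : ℝ}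
    (hl : ∀ i, hA.1.eigenvalues i ≤ l) : hA.sqrt ≤ Real.sqrt l • (1 : Matrix n n ℝ) := by
  rw [hA.sqrt_eq_cfc, ← Algebra.algebraMap_eq_smul_one]
  refine (cfc_le_algebraMap_iff Real.sqrt _ A (ha := hA.1)).2 fun x hx ↦ ?_
  rw [hA.1.spectrum_real_eq_range_eigenvalues] at hx
  obtain ⟨i, rfl⟩ := hx
  exact Real.sqrt_le_sqrt (hl i)

/-- A lower bound `c ≤ P` with `0 ≤ c` squares to `c² ≤ P²`, here tested against `D²`. -/
lemma sq_mul_trace_le_trace_of_smul_one_le {P D : Matrix n n ℝ} {c : ℝ} (hc : 0 ≤ c)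
    (hD : D.IsHermitian) (hP : c • (1 : Matrix n n ℝ) ≤ P) :
    c ^ 2 * (D * D).trace ≤ (D * (P * P) * D).trace := by
  have hone : (c • (1 : Matrix n n ℝ)).PosSemidef := PosSemidef.one.smul hc
  have hsum : (P + c • (1 : Matrix n n ℝ)).PosSemidef := by
    have := (Matrix.le_iff.1 hP).add (hone.add hone)
    rwa [show P - c • (1 : Matrix n n ℝ) + (c • 1 + c • 1) = P + c • 1 by abel] at this
  have hprod := (Matrix.le_iff.1 hP).mul_of_commute hsum (by
    simp only [commute_iff_eq, sub_mul, mul_add, mul_sub, add_mul, smul_mul_assoc, mul_smul_comm,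
      mul_one, one_mul]
    module)
  have htr := (hprod.mul_mul_conjTranspose_same D).trace_nonneg
  rw [hD.eq, show D * ((P - c • 1) * (P + c • 1)) * D = D * (P * P) * D - c ^ 2 • (D * D) by
    simp only [sub_mul, mul_add, mul_sub, add_mul, smul_mul_assoc, mul_smul_comm, mul_one,
      one_mul]
    module] at htr
  simpa [trace_sub, trace_smul] using htr

/-- An upper bound `P ≤ c` for `0 ≤ P` squares to `P² ≤ c²`, here tested against `D²`. -/
lemma trace_le_sq_mul_trace_of_le_smul_one {P D : Matrix n n ℝ} {c : ℝ} (hc : 0 ≤ c)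
    (hD : D.IsHermitian) (hP₀ : P.PosSemidef) (hP : P ≤ c • (1 : Matrix n n ℝ)) :
    (D * (P * P) * D).trace ≤ c ^ 2 * (D * D).trace := by
  have hsum : (P + c • (1 : Matrix n n ℝ)).PosSemidef := hP₀.add (PosSemidef.one.smul hc)
  have hprod := (Matrix.le_iff.1 hP).mul_of_commute hsum (by
    simp only [commute_iff_eq, sub_mul, mul_add, mul_sub, add_mul, smul_mul_assoc, mul_smul_comm,
      mul_one, one_mul]
    module)
  have htr := (hprod.mul_mul_conjTranspose_same D).trace_nonneg
  rw [hD.eq, show D * ((c • 1 - P) * (P + c • 1)) * D = c ^ 2 • (D * D) - D * (P * P) * D by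
    simp only [sub_mul, mul_add, mul_sub, add_mul, smul_mul_assoc, mul_smul_comm, mul_one,
      one_mul]
    module] at htr
  simpa [trace_sub, trace_smul] using htr

end SquareRoot

lemma frobSq_eq_trace {n : ℕ} (A : Matrix (Fin n) (Fin n) ℝ) : frobSq A = (A * Aᵀ).trace := by
  simp [frobSq, trace, mul_apply, sq]

/-- For commuting covariances the Bures term is `Tr ((Σ₁^{1/2} - Σ₂^{1/2})²)`. -/
lemma trace_add_trace_sub_two_mul_trace_sqrt {n : ℕ} {S₁ S₂ : Matrix (Fin n) (Fin n) ℝ}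
    (h1 : S₁.PosSemidef) (h2 : S₂.PosSemidef) (hcomm : Commute S₁ S₂) :
    S₁.trace + S₂.trace - 2 * ((mid_posSemidef h1 h2).sqrt).trace =
      ((h1.sqrt - h2.sqrt) * (h1.sqrt - h2.sqrt)).trace := by
  have hc := h1.commute_sqrt h2 hcomm
  have hmid : (mid_posSemidef h1 h2).sqrt = h1.sqrt * h2.sqrt := by
    refine PosSemidef.sqrt_eq_of_mul_self_eq _
      (h1.posSemidef_sqrt.mul_of_commute h2.posSemidef_sqrt hc) ?_
    nth_rewrite 2 [hc.eq]
    rw [mul_assoc, ← mul_assoc h2.sqrt, h2.sqrt_mul_sqrt_self, ← mul_assoc]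
  rw [hmid, sub_mul, mul_sub, mul_sub, h1.sqrt_mul_sqrt_self, h2.sqrt_mul_sqrt_self, ← hc.eq]
  simp only [trace_sub]
  ring

lemma frobSq_sub_eq_trace_sqrt {n : ℕ} {S₁ S₂ : Matrix (Fin n) (Fin n) ℝ}
    (h1 : S₁.PosSemidef) (h2 : S₂.PosSemidef) (hcomm : Commute S₁ S₂) :
    frobSq (S₁ - S₂) = ((h1.sqrt - h2.sqrt) * ((h1.sqrt + h2.sqrt) * (h1.sqrt + h2.sqrt)) *
      (h1.sqrt - h2.sqrt)).trace := by
  have hc := h1.commute_sqrt h2 hcomm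
  have hT : (S₁ - S₂)ᵀ = S₁ - S₂ := by
    simpa only [conjTranspose_eq_transpose_of_trivial] using (h1.1.sub h2.1).eq
  have hleft : S₁ - S₂ = (h1.sqrt - h2.sqrt) * (h1.sqrt + h2.sqrt) := by
    rw [← hc.mul_self_sub_mul_self_eq', h1.sqrt_mul_sqrt_self, h2.sqrt_mul_sqrt_self]
  have hright : S₁ - S₂ = (h1.sqrt + h2.sqrt) * (h1.sqrt - h2.sqrt) := by
    rw [← hc.mul_self_sub_mul_self_eq, h1.sqrt_mul_sqrt_self, h2.sqrt_mul_sqrt_self]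
  rw [frobSq_eq_trace, hT]
  nth_rewrite 1 [hleft]
  rw [hright]
  simp only [mul_assoc]

/-- Lipschitz-equivalence of the descriptor distance and the squared Gaussian
2-Wasserstein distance for commuting PSD covariances with eigenvalues in
`[λ_min, λ_max]`. -/
theorem descriptor_wasserstein_equiv {n : ℕ} (hn : 1 ≤ n)
    {S₁ S₂ : Matrix (Fin n) (Fin n) ℝ}
    (h1 : S₁.PosSemidef) (h2 : S₂.PosSemidef)
    (hcomm : S₁ * S₂ = S₂ * S₁)
    (μ₁ μ₂ : Fin n → ℝ)
    {lmin lmax : ℝ} (hmin : 0 < lmin) (hml : lmin ≤ lmax)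
    (hev1 : ∀ i, h1.1.eigenvalues i ∈ Set.Icc lmin lmax)
    (hev2 : ∀ i, h2.1.eigenvalues i ∈ Set.Icc lmin lmax) :
    (min 1 (1 / (2 * Real.sqrt lmax))) ^ 2 *
        ((∑ i, (μ₁ i - μ₂ i) ^ 2) + frobSq (S₁ - S₂)) ≤
      (∑ i, (μ₁ i - μ₂ i) ^ 2) + S₁.trace + S₂.trace -
        2 * ((mid_posSemidef h1 h2).sqrt).trace ∧
    (∑ i, (μ₁ i - μ₂ i) ^ 2) + S₁.trace + S₂.trace -
        2 * ((mid_posSemidef h1 h2).sqrt).trace ≤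
      (max 1 (1 / (2 * Real.sqrt lmin))) ^ 2 *
        ((∑ i, (μ₁ i - μ₂ i) ^ 2) + frobSq (S₁ - S₂)) := by
  have hmax : 0 < lmax := hmin.trans_le hml
  have hD : (h1.sqrt - h2.sqrt).IsHermitian := h1.posSemidef_sqrt.1.sub h2.posSemidef_sqrt.1
  open scoped MatrixOrder in
  have hlow := sq_mul_trace_le_trace_of_smul_one_le (P := h1.sqrt + h2.sqrt) (c := √lmin + √lmin)
    (by positivity) hD (by
      rw [add_smul]
      exact add_le_add (h1.smul_one_le_sqrt fun i ↦ (hev1 i).1)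
        (h2.smul_one_le_sqrt fun i ↦ (hev2 i).1))
  open scoped MatrixOrder in
  have hupp := trace_le_sq_mul_trace_of_le_smul_one (c := √lmax + √lmax) (by positivity) hD
    (h1.posSemidef_sqrt.add h2.posSemidef_sqrt)
    (by
      rw [add_smul]
      exact add_le_add (h1.sqrt_le_smul_one fun i ↦ (hev1 i).2)
        (h2.sqrt_le_smul_one fun i ↦ (hev2 i).2))
  have hT : 0 ≤ ((h1.sqrt - h2.sqrt) * (h1.sqrt - h2.sqrt)).trace := by
    simpa only [hD.eq] using (posSemidef_self_mul_conjTranspose (h1.sqrt - h2.sqrt)).trace_nonneg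
  rw [← frobSq_sub_eq_trace_sqrt h1 h2 hcomm, ← two_mul] at hlow hupp
  rw [add_assoc, add_sub_assoc, trace_add_trace_sub_two_mul_trace_sqrt h1 h2 hcomm]
  have hM : 0 ≤ ∑ i, (μ₁ i - μ₂ i) ^ 2 := by positivity
  have hF : 0 ≤ frobSq (S₁ - S₂) := by unfold frobSq; positivity
  generalize ∑ i, (μ₁ i - μ₂ i) ^ 2 = M at *
  generalize frobSq (S₁ - S₂) = F at *
  generalize ((h1.sqrt - h2.sqrt) * (h1.sqrt - h2.sqrt)).trace = T at *
  rw [mul_add, mul_add]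
  constructor
  · refine add_le_add (mul_le_of_le_one_left hM (pow_le_one₀ (by positivity) (min_le_left _ _))) ?_
    calc _ ≤ (1 / (2 * √lmax)) ^ 2 * F := by gcongr; exact min_le_right _ _
      _ ≤ T := by
        rw [one_div, inv_pow]
        exact inv_mul_le_of_le_mul₀ (by positivity) hT hupp
  · refine add_le_add (le_mul_of_one_le_left hM (one_le_pow₀ (le_max_left _ _))) ?_
    calc T ≤ (1 / (2 * √lmin)) ^ 2 * F := by
          rw [one_div, inv_pow]
          exact (le_inv_mul_iff₀ (by positivity)).2 hlow
      _ ≤ _ := by gcongr; exact le_max_right _ _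
end

section
/- Let 0 < λ_min ≤ λ_max and let A, B be real symmetric positive semidefinite n×n matrices with AB = BA such that every eigenvalue of A and of B lies in [λ_min, λ_max]. Then (1/(2√λ_max)) · ‖A − B‖_F ≤ ‖A^{1/2} − B^{1/2}‖_F ≤ (1/(2√λ_min)) · ‖A − B‖_F. -/
open Matrix
open scoped MatrixOrder

/-- Frobenius norm `‖A‖_F = √(∑ i j, (A i j)²)`. -/
noncomputable def frobNorm {n : ℕ} (A : Matrix (Fin n) (Fin n) ℝ) : ℝ :=
  Real.sqrt (∑ i, ∑ j, (A i j) ^ 2)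

theorem frobNorm_eq_sqrt_trace {n : ℕ} (X : Matrix (Fin n) (Fin n) ℝ) :
    frobNorm X = Real.sqrt (Xᴴ * X).trace := by
  rw [frobNorm, Finset.sum_comm]
  simp [Matrix.trace, Matrix.mul_apply, pow_two]

theorem frobNorm_le_of_conjTranspose_mul_self_le {n : ℕ} {X Y : Matrix (Fin n) (Fin n) ℝ}
    (h : Xᴴ * X ≤ Yᴴ * Y) : frobNorm X ≤ frobNorm Y := by
  rw [frobNorm_eq_sqrt_trace, frobNorm_eq_sqrt_trace]
  apply Real.sqrt_le_sqrt
  have := (Matrix.le_iff.mp h).trace_nonneg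
  rwa [Matrix.trace_sub, sub_nonneg] at this

theorem frobNorm_mul_le_mul {n : ℕ} {P Q : Matrix (Fin n) (Fin n) ℝ}
    (hP : 0 ≤ P) (hPQ : P ≤ Q) (hcomm : Commute P Q) (D : Matrix (Fin n) (Fin n) ℝ) :
    frobNorm (P * D) ≤ frobNorm (Q * D) := by
  have hQ : 0 ≤ Q := hP.trans hPQ
  have hsq : 0 ≤ (Q - P) * (Q + P) :=
    Commute.mul_nonneg (sub_nonneg.mpr hPQ) (add_nonneg hQ hP)
      (((Commute.refl Q).sub_left hcomm).add_right (hcomm.symm.sub_left (Commute.refl P)))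
  rw [← hcomm.symm.mul_self_sub_mul_self_eq'] at hsq
  apply frobNorm_le_of_conjTranspose_mul_self_le
  rw [Matrix.le_iff]
  convert hsq.posSemidef.conjTranspose_mul_mul_same D using 1
  simp only [Matrix.conjTranspose_mul, hP.posSemidef.1.eq, hQ.posSemidef.1.eq]
  noncomm_ring

theorem frobNorm_algebraMap_mul {n : ℕ} {c : ℝ} (hc : 0 ≤ c) (X : Matrix (Fin n) (Fin n) ℝ) :
    frobNorm (algebraMap ℝ _ c * X) = c * frobNorm X := by
  rw [← Algebra.smul_def, frobNorm, frobNorm]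
  simp only [Matrix.smul_apply, smul_eq_mul, mul_pow, ← Finset.mul_sum]
  rw [Real.sqrt_mul (sq_nonneg c), Real.sqrt_sq hc]

theorem sqrt_mem_Icc_of_eigenvalues {n : ℕ} {A : Matrix (Fin n) (Fin n) ℝ}
    (hA : A.PosSemidef) {a b : ℝ} (hev : ∀ i, hA.1.eigenvalues i ∈ Set.Icc a b) :
    CFC.sqrt A ∈ Set.Icc (algebraMap ℝ _ (Real.sqrt a)) (algebraMap ℝ _ (Real.sqrt b)) := by
  have hspec : ∀ x ∈ spectrum ℝ A, x ∈ Set.Icc a b := by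
    intro x hx
    rw [hA.1.spectrum_real_eq_range_eigenvalues] at hx
    obtain ⟨i, rfl⟩ := hx
    exact hev i
  have hsa : IsSelfAdjoint A := hA.1
  rw [CFC.sqrt_eq_real_sqrt A hA.nonneg, cfcₙ_eq_cfc]
  exact ⟨algebraMap_le_cfc _ _ _ fun x hx => Real.sqrt_le_sqrt (hspec x hx).1,
    cfc_le_algebraMap _ _ _ fun x hx => Real.sqrt_le_sqrt (hspec x hx).2⟩

theorem commute_sqrt_sqrt {n : ℕ} {A B : Matrix (Fin n) (Fin n) ℝ} (h : Commute A B) :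
    Commute (CFC.sqrt A) (CFC.sqrt B) :=
  ((h.cfcₙ_nnreal NNReal.sqrt).symm.cfcₙ_nnreal NNReal.sqrt).symm

/-- For commuting real PSD matrices `A, B` with eigenvalues in `[λ_min, λ_max]`,
`(1/(2√λ_max)) ‖A − B‖_F ≤ ‖A^{1/2} − B^{1/2}‖_F ≤ (1/(2√λ_min)) ‖A − B‖_F`. -/
theorem frobNorm_sqrt_sub_bounds {n : ℕ} {A B : Matrix (Fin n) (Fin n) ℝ}
    (hA : A.PosSemidef) (hB : B.PosSemidef) (hcomm : A * B = B * A)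
    {lmin lmax : ℝ} (hmin : 0 < lmin) (hml : lmin ≤ lmax)
    (hevA : ∀ i, hA.1.eigenvalues i ∈ Set.Icc lmin lmax)
    (hevB : ∀ i, hB.1.eigenvalues i ∈ Set.Icc lmin lmax) :
    (1 / (2 * Real.sqrt lmax)) * frobNorm (A - B) ≤ frobNorm (CFC.sqrt A - CFC.sqrt B) ∧
    frobNorm (CFC.sqrt A - CFC.sqrt B) ≤ (1 / (2 * Real.sqrt lmin)) * frobNorm (A - B) := by
  obtain ⟨hAl, hAu⟩ := sqrt_mem_Icc_of_eigenvalues hA hevA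
  obtain ⟨hBl, hBu⟩ := sqrt_mem_Icc_of_eigenvalues hB hevB
  have hST : Commute (CFC.sqrt A) (CFC.sqrt B) := commute_sqrt_sqrt hcomm
  have hfac : A - B = (CFC.sqrt A + CFC.sqrt B) * (CFC.sqrt A - CFC.sqrt B) := by
    rw [← hST.mul_self_sub_mul_self_eq, CFC.sqrt_mul_sqrt_self A hA.nonneg,
      CFC.sqrt_mul_sqrt_self B hB.nonneg]
  have hlow := add_le_add hAl hBl
  have hupp := add_le_add hAu hBu
  rw [← map_add, ← two_mul] at hlow hupp
  have hsmin : 0 < 2 * Real.sqrt lmin := by positivity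
  have hsmax : 0 < 2 * Real.sqrt lmax := mul_pos two_pos (Real.sqrt_pos.mpr (hmin.trans_le hml))
  have hscalar : (0 : Matrix (Fin n) (Fin n) ℝ) ≤ algebraMap ℝ _ (2 * Real.sqrt lmin) :=
    algebraMap_nonneg _ hsmin.le
  rw [one_div, one_div, inv_mul_le_iff₀ hsmax, le_inv_mul_iff₀ hsmin, hfac,
    ← frobNorm_algebraMap_mul hsmax.le, ← frobNorm_algebraMap_mul hsmin.le]
  exact ⟨frobNorm_mul_le_mul (hscalar.trans hlow) hupp (Algebra.commutes _ _).symm _,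
    frobNorm_mul_le_mul hscalar hlow (Algebra.commutes _ _) _⟩
end
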